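/- Define β₁ = 1, β₂ = 2, γ₂ = γ′₂ = 1, and for s ≥ 2: β_{s+1} = 2β_s + β_{s−1}, γ_{s+1} = β_s + γ′_s, γ′_{s+1} = β_{s+1} − β_s + γ_s. For every s ≥ 3, taking a = β_{s−1}, b = β_s, and c = γ_s(β_{s−1} + β_s) if s is even, c = γ_{s+1}β_{s−1} + γ_{s−1}β_s if s is odd, one has |𝒩(a,b,c)| = 2s. -/

import Mathlib

/-- `𝒩(a,b,c)`: the set of vertices (extreme points) of the convex hull of
`{(x,y) ∈ ℤ² : x ≥ 0, y ≥ 0, ax + by ≤ c}`, the two-dimensional knapsack polytope. -/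
def twoKnapVert (a b c : ℕ) : Set (ℝ × ℝ) :=
  Set.extremePoints ℝ (convexHull ℝ
    {p : ℝ × ℝ | (∃ x : ℤ, p.1 = (x : ℝ)) ∧ (∃ y : ℤ, p.2 = (y : ℝ)) ∧
      0 ≤ p.1 ∧ 0 ≤ p.2 ∧ (a : ℝ) * p.1 + (b : ℝ) * p.2 ≤ (c : ℝ)})

/-- The sequence `β₁ = 1, β₂ = 2, β_{s+1} = 2β_s + β_{s−1}` (`s ≥ 2`), extended by
`β₀ = 0` (which is consistent with the recurrence). -/
def beta : ℕ → ℕ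
  | 0 => 0
  | 1 => 1
  | n + 2 => 2 * beta (n + 1) + beta n

/-- The pair `(γ_s, γ′_s)`: `γ₂ = γ′₂ = 1`, and for `s ≥ 2`
`γ_{s+1} = β_s + γ′_s`, `γ′_{s+1} = β_{s+1} − β_s + γ_s`.
(Values at indices `0, 1` are irrelevant placeholders.) -/
def gam : ℕ → ℕ × ℕ
  | 0 => (1, 1)
  | 1 => (1, 1)
  | 2 => (1, 1)
  | n + 3 => (beta (n + 2) + (gam (n + 2)).2, beta (n + 3) - beta (n + 2) + (gam (n + 2)).1)

lemma ext_aux (S : Set (ℝ × ℝ)) (p : ℝ × ℝ) (hp : p ∈ S) (f1 f2 g1 g2 : ℝ)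
    (hf : ∀ q ∈ S, f1 * (q.1 - p.1) + f2 * (q.2 - p.2) ≤ 0)
    (hg : ∀ q ∈ S, g1 * (q.1 - p.1) + g2 * (q.2 - p.2) ≤ 0)
    (hdet : f1 * g2 - f2 * g1 ≠ 0) : p ∈ Set.extremePoints ℝ (convexHull ℝ S) := by
  have key : ∀ h1 h2 : ℝ, (∀ q ∈ S, h1 * (q.1 - p.1) + h2 * (q.2 - p.2) ≤ 0) →
      ∀ q ∈ convexHull ℝ S, h1 * (q.1 - p.1) + h2 * (q.2 - p.2) ≤ 0 := by
    intro h1 h2 h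
    have hc : Convex ℝ {q : ℝ × ℝ | h1 * (q.1 - p.1) + h2 * (q.2 - p.2) ≤ 0} := by
      intro u hu v hv α β hα hβ hαβ
      simp only [Set.mem_ofPred_eq, Prod.fst_add, Prod.snd_add, Prod.smul_fst, Prod.smul_snd,
        smul_eq_mul] at *
      have hβ' : β = 1 - α := by linarith
      have := mul_nonneg hα (neg_nonneg.mpr hu)
      have := mul_nonneg hβ (neg_nonneg.mpr hv)
      subst hβ'
      nlinarith
    intro q hq
    exact convexHull_min (s := S) (fun q hq => h q hq) hc hq
  refine mem_extremePoints.mpr ⟨subset_convexHull ℝ S hp, ?_⟩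
  intro u hu v hv hseg
  obtain ⟨α, β, hα, hβ, hαβ, he⟩ := hseg
  have e1 : α * u.1 + β * v.1 = p.1 := by rw [← he]; simp
  have e2 : α * u.2 + β * v.2 = p.2 := by rw [← he]; simp
  have tight : ∀ h1 h2 : ℝ, (∀ q ∈ S, h1 * (q.1 - p.1) + h2 * (q.2 - p.2) ≤ 0) →
      h1 * (u.1 - p.1) + h2 * (u.2 - p.2) = 0 ∧ h1 * (v.1 - p.1) + h2 * (v.2 - p.2) = 0 := by
    intro h1 h2 h
    have a1 := key h1 h2 h u hu
    have a2 := key h1 h2 h v hv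
    have hs : α * (h1 * (u.1 - p.1) + h2 * (u.2 - p.2))
        + β * (h1 * (v.1 - p.1) + h2 * (v.2 - p.2)) = 0 := by
      have : β = 1 - α := by linarith
      subst this
      linear_combination h1 * e1 + h2 * e2
    constructor
    · refine le_antisymm a1 ?_
      by_contra hlt
      push Not at hlt
      have := mul_neg_of_pos_of_neg hα hlt
      have := mul_nonpos_of_nonneg_of_nonpos hβ.le a2
      linarith
    · refine le_antisymm a2 ?_
      by_contra hlt
      push Not at hlt
      have := mul_neg_of_pos_of_neg hβ hlt
      have := mul_nonpos_of_nonneg_of_nonpos hα.le a1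
      linarith
  obtain ⟨fu, fv⟩ := tight f1 f2 hf
  obtain ⟨gu, gv⟩ := tight g1 g2 hg
  have fin : ∀ w : ℝ × ℝ, f1 * (w.1 - p.1) + f2 * (w.2 - p.2) = 0 →
      g1 * (w.1 - p.1) + g2 * (w.2 - p.2) = 0 → w = p := by
    intro w h1 h2
    have k1 : (f1 * g2 - f2 * g1) * (w.1 - p.1) = 0 := by linear_combination g2 * h1 - f2 * h2
    have k2 : (f1 * g2 - f2 * g1) * (w.2 - p.2) = 0 := by linear_combination f1 * h2 - g1 * h1
    have k1 := (mul_eq_zero.mp k1).resolve_left hdet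
    have k2 := (mul_eq_zero.mp k2).resolve_left hdet
    exact Prod.ext (by linarith) (by linarith)
  exact ⟨fin u fu gu, fin v fv gv⟩

lemma not_ext_aux (C : Set (ℝ × ℝ)) (e u v : ℝ × ℝ) (t : ℝ) (ht0 : 0 < t) (ht1 : t < 1)
    (hu : u ∈ C) (hv : v ∈ C) (h1 : (1 - t) * u.1 + t * v.1 = e.1)
    (h2 : (1 - t) * u.2 + t * v.2 = e.2) (hne : u ≠ e) : e ∉ Set.extremePoints ℝ C := by
  intro he
  have := (mem_extremePoints.mp he).2 u hu v hv
    ⟨1 - t, t, by linarith, ht0, by ring, Prod.ext (by simpa using h1) (by simpa using h2)⟩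
  exact hne this.1

lemma poly_card (a b c : ℕ) (n : ℕ) (hn : 1 ≤ n) (X Y : ℕ → ℤ) (hX0 : X 0 = 0)
    (hXm : ∀ i < n, X i < X (i + 1)) (hYpos : ∀ i < n, 0 < Y i) (hYn : Y n = 0)
    (hmem : ∀ i ≤ n, (a : ℤ) * X i + b * Y i ≤ c)
    (hedge : ∀ i < n, ∀ x y : ℤ, 0 ≤ x → 0 ≤ y → (a : ℤ) * x + b * y ≤ c →
      (Y i - Y (i + 1)) * (x - X i) + (X (i + 1) - X i) * (y - Y i) ≤ 0)
    (hdet : ∀ i, i + 1 < n → (Y i - Y (i + 1)) * (X (i + 2) - X (i + 1))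
      - (X (i + 1) - X i) * (Y (i + 1) - Y (i + 2)) ≠ 0) :
    (twoKnapVert a b c).ncard = n + 2 := by
  have hmono : ∀ j ≤ n, ∀ i < j, X i < X j := by
    intro j
    induction j with
    | zero => intro _ i hi; omega
    | succ j ih =>
      intro hj i hi
      rcases Nat.lt_succ_iff_lt_or_eq.mp hi with h | h
      · exact (ih (by omega) i h).trans (hXm j (by omega))
      · subst h; exact hXm i (by omega)
  have hXnn : ∀ i ≤ n, 0 ≤ X i := by
    intro i hi
    rcases Nat.eq_zero_or_pos i with h | h
    · subst h; omega
    · have := hmono i hi 0 h; omega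
  have hYnn : ∀ i ≤ n, 0 ≤ Y i := by
    intro i hi
    rcases Nat.lt_or_eq_of_le hi with h | h
    · exact (hYpos i h).le
    · subst h; omega
  set S : Set (ℝ × ℝ) := {p : ℝ × ℝ | (∃ x : ℤ, p.1 = (x : ℝ)) ∧ (∃ y : ℤ, p.2 = (y : ℝ)) ∧
      0 ≤ p.1 ∧ 0 ≤ p.2 ∧ (a : ℝ) * p.1 + (b : ℝ) * p.2 ≤ (c : ℝ)} with hS
  have memS : ∀ x y : ℤ, 0 ≤ x → 0 ≤ y → (a : ℤ) * x + b * y ≤ c → ((x : ℝ), (y : ℝ)) ∈ S := by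
    intro x y hx hy h
    refine ⟨⟨x, rfl⟩, ⟨y, rfl⟩, Int.cast_nonneg hx, Int.cast_nonneg hy, ?_⟩
    simp only
    exact_mod_cast h
  have ofS : ∀ q ∈ S, ∃ x y : ℤ, 0 ≤ x ∧ 0 ≤ y ∧ (a : ℤ) * x + b * y ≤ c ∧ q = ((x : ℝ), (y : ℝ)) := by
    rintro ⟨q1, q2⟩ ⟨⟨x, hx⟩, ⟨y, hy⟩, h1, h2, h3⟩
    simp only at hx hy h1 h2 h3
    subst hx hy
    exact ⟨x, y, by exact_mod_cast h1, by exact_mod_cast h2, by exact_mod_cast h3, rfl⟩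
  let P : ℕ → ℝ × ℝ := fun i => ((X i : ℝ), (Y i : ℝ))
  have hPS : ∀ i ≤ n, P i ∈ S := fun i hi => memS _ _ (hXnn i hi) (hYnn i hi) (hmem i hi)
  have hQS : ∀ i ≤ n, ((X i : ℝ), (0 : ℝ)) ∈ S := by
    intro i hi
    have := memS (X i) 0 (hXnn i hi) le_rfl (by
      have := hmem i hi
      have := mul_nonneg (Int.natCast_nonneg b) (hYnn i hi)
      linarith)
    simpa using this
  have hOS : ((0 : ℝ), (0 : ℝ)) ∈ S := by have := hQS 0 (by omega); simpa [hX0] using this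
  have hedgeR : ∀ i < n, ∀ q ∈ S, ((Y i : ℝ) - Y (i + 1)) * (q.1 - X i)
      + ((X (i + 1) : ℝ) - X i) * (q.2 - Y i) ≤ 0 := by
    intro i hi q hq
    obtain ⟨x, y, hx, hy, h, rfl⟩ := ofS q hq
    have := hedge i hi x y hx hy h
    simp only
    exact_mod_cast this
  have hedgeR' : ∀ i < n, ∀ q ∈ S, ((Y i : ℝ) - Y (i + 1)) * (q.1 - X (i + 1))
      + ((X (i + 1) : ℝ) - X i) * (q.2 - Y (i + 1)) ≤ 0 := by
    intro i hi q hq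
    have := hedgeR i hi q hq
    linarith
  have hxnn : ∀ q ∈ S, 0 ≤ q.1 := fun q hq => hq.2.2.1
  have hynn : ∀ q ∈ S, 0 ≤ q.2 := fun q hq => hq.2.2.2.1
  have main : twoKnapVert a b c = insert ((0 : ℝ), (0 : ℝ)) (P '' (Finset.range (n + 1) : Set ℕ)) := by
    change Set.extremePoints ℝ (convexHull ℝ S) = _
    apply Set.Subset.antisymm
    · intro e he
      have heS : e ∈ S := extremePoints_convexHull_subset he
      obtain ⟨x, y, hx, hy, hxy, rfl⟩ := ofS e heS
      by_contra hcon
      have hne0 : ¬ (x = 0 ∧ y = 0) := by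
        rintro ⟨h1, h2⟩
        apply hcon; left; simp [h1, h2]
      have hneP : ∀ i ≤ n, ¬ (x = X i ∧ y = Y i) := by
        rintro i hi ⟨h1, h2⟩
        apply hcon; right
        exact ⟨i, by simp; omega, by simp [P, h1, h2]⟩
      have hxn : x ≤ X n := by
        obtain ⟨m, rfl⟩ : ∃ m, n = m + 1 := ⟨n - 1, by omega⟩
        have h1 := hedge m (by omega) x y hx hy hxy
        have h2 := hYpos m (by omega)
        have h3 := hXm m (by omega)
        rw [hYn] at h1
        by_contra hlt
        push Not at hlt
        nlinarith [mul_pos h2 (sub_pos.mpr hlt), mul_nonneg (sub_pos.mpr h3).le hy]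
      have hcol : ∀ i ≤ n, ∀ w : ℝ, 0 ≤ w → w ≤ 1 → ((X i : ℝ), w * (Y i : ℝ)) ∈ convexHull ℝ S := by
        intro i hi w h0 h1
        have := (convex_convexHull ℝ S) (subset_convexHull ℝ S (hQS i hi))
          (subset_convexHull ℝ S (hPS i hi)) (sub_nonneg.mpr h1) h0 (by ring)
        convert this using 1
        apply Prod.ext
        · simp [P]; ring
        · simp [P]
      -- find the index
      obtain ⟨i, hi, hle, hlt⟩ : ∃ i, i ≤ n ∧ X i ≤ x ∧ ∀ j ≤ n, i < j → x < X j := by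
        classical
        let F := (Finset.range (n + 1)).filter (fun i => X i ≤ x)
        have hF : F.Nonempty := ⟨0, by simp [F]; omega⟩
        obtain ⟨hm1, hm2⟩ := Finset.mem_filter.mp (F.max'_mem hF)
        have hm1 := Finset.mem_range.mp hm1
        refine ⟨F.max' hF, by omega, hm2, ?_⟩
        intro j hj hlt
        by_contra hc
        have : j ≤ F.max' hF := F.le_max' j (by simp [F]; omega)
        omega
      rcases eq_or_lt_of_le hle with heq | hlt2
      · -- on a column
        have hyY : y ≤ Y i := by
          rcases Nat.lt_or_eq_of_le hi with h | h
          · have h1 := hedge i h x y hx hy hxy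
            have h3 := hXm i h
            rw [heq] at h1
            nlinarith
          · obtain ⟨m, hm⟩ : ∃ m, n = m + 1 := ⟨n - 1, by omega⟩
            subst h
            have h1 := hedge m (by omega) x y hx hy hxy
            have h3 := hXm m (by omega)
            rw [← hm, ← heq] at h1
            rw [← hm] at h3
            nlinarith
        have hyY' : y < Y i := lt_of_le_of_ne hyY (fun h => hneP i hi ⟨heq.symm, h⟩)
        rcases eq_or_lt_of_le hy with hy0 | hy0
        · -- y = 0
          have hin : i < n := by
            rcases Nat.lt_or_eq_of_le hi with h | h
            · exact h
            · subst h; omega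
          have hxpos : 0 < x := lt_of_le_of_ne hx (fun h => hne0 ⟨h.symm, hy0.symm⟩)
          have hxlt : x < X n := hlt n le_rfl hin
          have hxposR : (0 : ℝ) < x := by exact_mod_cast hxpos
          have hxltR : (x : ℝ) < X n := by exact_mod_cast hxlt
          have hnpos : (0 : ℝ) < X n := by linarith
          refine not_ext_aux _ _ (0, 0) ((X n : ℝ), 0) (x / X n) (by positivity)
            ((div_lt_one hnpos).mpr hxltR) (subset_convexHull ℝ S hOS)
            (subset_convexHull ℝ S (hQS n le_rfl)) ?_ ?_ ?_ he
          · simp; field_simp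
          · simp [← hy0]
          · intro h
            have := congrArg Prod.fst h
            simp at this
            linarith
        · have hyR : (0 : ℝ) < y := by exact_mod_cast hy0
          have hyYR : (y : ℝ) < Y i := by exact_mod_cast hyY'
          have hYp : (0 : ℝ) < Y i := by linarith
          refine not_ext_aux _ _ ((X i : ℝ), 0) (P i) (y / Y i) (by positivity)
            ((div_lt_one hYp).mpr hyYR) (subset_convexHull ℝ S (hQS i hi))
            (subset_convexHull ℝ S (hPS i hi)) ?_ ?_ ?_ he
          · simp [P, heq]; ring
          · simp [P]; field_simp
          · intro h
            have h2 : (0 : ℝ) = y := congrArg Prod.snd h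
            linarith
      · -- strictly between columns
        have hin : i < n := by
          rcases Nat.lt_or_eq_of_le hi with h | h
          · exact h
          · subst h; omega
        have hlt3 : x < X (i + 1) := hlt (i + 1) (by omega) (by omega)
        have r1 : (X i : ℝ) < x := by exact_mod_cast hlt2
        have r2 : (x : ℝ) < X (i + 1) := by exact_mod_cast hlt3
        have r3 : (0 : ℝ) < Y i := by exact_mod_cast hYpos i hin
        have r4 : (0 : ℝ) ≤ Y (i + 1) := by exact_mod_cast hYnn (i + 1) (by omega)
        have r5 : (0 : ℝ) ≤ y := by exact_mod_cast hy
        have r6 := hedgeR i hin _ heS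
        simp only at r6
        have hW : (0 : ℝ) < X (i + 1) - X i := by linarith
        set t : ℝ := (x - X i) / (X (i + 1) - X i) with ht
        have htW : t * (X (i + 1) - X i) = x - X i := by rw [ht]; field_simp
        have ht0 : 0 < t := div_pos (by linarith) hW
        have ht1 : t < 1 := (div_lt_one hW).mpr (by linarith)
        set H : ℝ := (1 - t) * Y i + t * Y (i + 1) with hH
        have hHpos : 0 < H := add_pos_of_pos_of_nonneg (mul_pos (by linarith) r3)
          (mul_nonneg ht0.le r4)
        have hyH : (y : ℝ) ≤ H := by
          have : (X (i + 1) - X i : ℝ) * (y - H) ≤ 0 := by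
            have : (X (i + 1) - X i : ℝ) * (y - H) = ((Y i : ℝ) - Y (i + 1)) * (x - X i)
              + ((X (i + 1) : ℝ) - X i) * (y - Y i) := by
              rw [hH, ← htW]; ring
            rw [this]; exact r6
          by_contra hc
          push Not at hc
          have := mul_pos hW (sub_pos.mpr hc)
          linarith
        have w0 : 0 ≤ (y : ℝ) / H := by positivity
        have w1 : (y : ℝ) / H ≤ 1 := (div_le_one hHpos).mpr hyH
        refine not_ext_aux _ _ _ _ t ht0 ht1 (hcol i hi _ w0 w1) (hcol (i + 1) (by omega) _ w0 w1)
          ?_ ?_ ?_ he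
        · simp only; linear_combination htW
        · simp only
          have : (y : ℝ) / H * H = y := by field_simp
          linear_combination this + (y : ℝ) / H * hH
        · intro h
          have := congrArg Prod.fst h
          simp at this
          omega
    · intro e he
      rcases he with rfl | ⟨i, hi, rfl⟩
      · refine ext_aux S _ hOS (-1) 0 0 (-1) ?_ ?_ (by norm_num)
        · intro q hq; have := hxnn q hq; simp; linarith
        · intro q hq; have := hynn q hq; simp; linarith
      · have hi : i ≤ n := by simp at hi; omega
        rcases Nat.eq_zero_or_pos i with h0 | h0
        · subst h0
          refine ext_aux S _ (hPS 0 hi) (-1) 0 _ _ ?_ (hedgeR 0 (by omega)) ?_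
          · intro q hq; have := hxnn q hq; simp [P, hX0]; linarith
          · have : (X 0 : ℝ) < X (0 + 1) := by exact_mod_cast hXm 0 (by omega)
            intro h; linarith
        · obtain ⟨j, rfl⟩ : ∃ j, i = j + 1 := ⟨i - 1, by omega⟩
          rcases Nat.lt_or_eq_of_le hi with h | h
          · refine ext_aux S _ (hPS _ hi) _ _ _ _ (hedgeR' j (by omega)) (hedgeR (j + 1) h) ?_
            have := hdet j h
            exact_mod_cast this
          · subst h
            refine ext_aux S _ (hPS _ hi) 0 (-1) _ _ ?_ (hedgeR' j (by omega)) ?_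
            · intro q hq; have := hynn q hq; simp [P, hYn]; linarith
            · have : (0 : ℝ) < Y j := by exact_mod_cast hYpos j (by omega)
              rw [hYn]
              intro h; push_cast at h; linarith
  rw [main]
  have hinj : Set.InjOn P (Finset.range (n + 1) : Set ℕ) := by
    intro i hi j hj hij
    simp only [Finset.coe_range, Set.mem_Iio] at hi hj
    have hX : X i = X j := by
      have := congrArg Prod.fst hij
      simp only [P] at this
      exact_mod_cast this
    rcases lt_trichotomy i j with h | h | h
    · have := hmono j (by omega) i h; omega
    · exact h
    · have := hmono i (by omega) j h; omega
  rw [Set.ncard_insert_of_notMem, Set.InjOn.ncard_image hinj, Set.ncard_coe_finset]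
  · simp
  · rintro ⟨i, hi, h⟩
    simp only [Finset.coe_range, Set.mem_Iio] at hi
    have h1 : X i = 0 := by
      have := congrArg Prod.fst h; simp only [P] at this; exact_mod_cast this
    have h2 : Y i = 0 := by
      have := congrArg Prod.snd h; simp only [P] at this; exact_mod_cast this
    rcases Nat.lt_or_eq_of_le (Nat.lt_succ_iff.mp hi) with h | h
    · have := hYpos i h; omega
    · subst h
      have := hmono i le_rfl 0 (by omega); omega

lemma beta_rec (n : ℕ) : (beta (n + 2) : ℤ) = 2 * beta (n + 1) + beta n := by
  rw [beta]; push_cast; ring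

lemma beta_mono_succ (n : ℕ) : beta n ≤ beta (n + 1) := by
  cases n with
  | zero => simp [beta]
  | succ n => rw [beta]; omega

lemma beta_pos (n : ℕ) : 0 < beta (n + 1) := by
  induction n with
  | zero => simp [beta]
  | succ n ih => exact ih.trans_le (beta_mono_succ _)

lemma beta_lt (n : ℕ) : beta (n + 1) < beta (n + 2) := by
  have := beta_pos n
  rw [beta]; omega

lemma beta_D (i r : ℕ) : (beta (i + r) : ℤ) * beta (i + 1) - beta (i + r + 1) * beta i
    = (-1) ^ i * beta r := by
  induction i with
  | zero => simp [beta]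
  | succ i ih =>
    have h1 := beta_rec i
    have h2 := beta_rec (i + r)
    rw [show i + 1 + r = i + r + 1 by ring, show i + 1 + 1 = i + 2 by ring,
      show i + r + 1 + 1 = i + r + 2 by ring, h1, h2, pow_succ]
    linear_combination -ih

lemma beta_D_even (i N : ℕ) (hi : Even i) (h : i ≤ N) :
    (beta N : ℤ) * beta (i + 1) - beta (N + 1) * beta i = beta (N - i) := by
  obtain ⟨r, rfl⟩ := Nat.exists_eq_add_of_le h
  rw [beta_D, hi.neg_one_pow]; simp

lemma beta_D_odd (i N : ℕ) (hi : Odd i) (h : i ≤ N) :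
    (beta (N + 1) : ℤ) * beta i - beta N * beta (i + 1) = beta (N - i) := by
  obtain ⟨r, rfl⟩ := Nat.exists_eq_add_of_le h
  have := beta_D i r
  rw [hi.neg_one_pow] at this
  simp only [Nat.add_sub_cancel_left]; linarith

def stp (f : ℕ → ℤ) (i : ℕ) : ℤ := if Even i then f (i + 1) else f (i + 2) - f (i + 1)

def cum (f : ℕ → ℤ) (i : ℕ) : ℤ := ∑ j ∈ Finset.range i, stp f j

lemma cum_zero (f : ℕ → ℤ) : cum f 0 = 0 := by simp [cum]

lemma cum_succ (f : ℕ → ℤ) (i : ℕ) : cum f (i + 1) = cum f i + stp f i := by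
  simp [cum, Finset.sum_range_succ]

def rr (i : ℕ) : ℤ := beta i
def hL (i : ℕ) : ℤ := beta (i + 1) - 2 * beta i
def hR (i : ℕ) : ℤ := beta (i + 1)

lemma hL_succ (i : ℕ) : hL (i + 1) = beta i := by
  have := beta_rec i
  simp only [hL]; linarith

lemma stp_even (f : ℕ → ℤ) {i : ℕ} (h : Even i) : stp f i = f (i + 1) := by simp [stp, h]
lemma stp_odd (f : ℕ → ℤ) {i : ℕ} (h : Odd i) : stp f i = f (i + 2) - f (i + 1) := by
  have := Nat.not_even_iff_odd.mpr h
  simp [stp, this]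

lemma stp_rr_pos (i : ℕ) : 0 < stp rr i := by
  have h1 := beta_pos i
  have h2 := beta_lt i
  rcases Nat.even_or_odd i with h | h
  · rw [stp_even _ h]; simp only [rr]; omega
  · rw [stp_odd _ h]; simp only [rr]; omega

lemma stp_hR_pos (i : ℕ) : 0 < stp hR i := by
  have h1 := beta_pos (i + 1)
  have h2 := beta_lt (i + 1)
  rcases Nat.even_or_odd i with h | h
  · rw [stp_even _ h]; simp only [hR]; omega
  · rw [stp_odd _ h]; simp only [hR]
    rw [show i + 2 + 1 = i + 1 + 2 by ring]; omega

lemma stp_hL_nonneg (i : ℕ) : 0 ≤ stp hL i := by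
  have h2 := beta_mono_succ i
  rcases Nat.even_or_odd i with h | h
  · rw [stp_even _ h, hL_succ]; omega
  · rw [stp_odd _ h, hL_succ, hL_succ]; omega

lemma cum_rr_bound (i : ℕ) : cum rr i < beta (i + 1) + (if Even i then (beta i : ℤ) else 0) := by
  induction i with
  | zero => simp [cum, beta]
  | succ i ih =>
    have h1 := beta_rec i
    rw [cum_succ]
    rcases Nat.even_or_odd i with h | h
    · have h' : ¬ Even (i + 1) := by simp [Nat.even_add_one, h]
      rw [stp_even _ h]
      simp only [h, h', if_true, if_false, rr] at *
      rw [show i + 1 + 1 = i + 2 by ring]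
      linarith
    · have h' : Even (i + 1) := h.add_one
      have h'' := Nat.not_even_iff_odd.mpr h
      rw [stp_odd _ h]
      simp only [h'', h', if_true, if_false, rr] at *
      rw [show i + 1 + 1 = i + 2 by ring]
      have : (0 : ℤ) ≤ beta (i + 1) := by positivity
      linarith

lemma edge_aux (x y X Y dx dy ex ey A B c σ δ ε τ : ℤ) (hdet : dx * ey - dy * ex = 1)
    (hx : 0 ≤ x) (hc : A * x + B * y ≤ c) (hσ : c - A * X - B * Y = σ)
    (hδ : A * dx - B * dy = δ) (hε : B * ey - A * ex = ε) (hδ0 : 0 ≤ δ) (hε0 : 0 ≤ ε)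
    (hdx : 0 < dx) (hex : 0 ≤ ex) (hX : X < ex + (1 - τ) * dx) (hσ' : σ < τ * δ + ε) :
    dy * (x - X) + dx * (y - Y) ≤ 0 := by
  by_contra hk
  push Not at hk
  obtain ⟨k, hkk⟩ : ∃ k, k = dy * (x - X) + dx * (y - Y) := ⟨_, rfl⟩
  obtain ⟨t, htt⟩ : ∃ t, t = ey * (x - X) + ex * (y - Y) := ⟨_, rfl⟩
  rw [← hkk] at hk
  have e1 : x = X + t * dx - k * ex := by
    rw [hkk, htt]; linear_combination (X - x) * hdet
  have e2 : y = Y - t * dy + k * ey := by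
    rw [hkk, htt]; linear_combination (Y - y) * hdet
  have e3 : t * δ + k * ε ≤ σ := by
    rw [← hσ, ← hδ, ← hε]
    rw [e1, e2] at hc
    linarith
  have h1 : 0 ≤ (k - 1) * ex := mul_nonneg (by omega) hex
  have h2 : 0 < (t - τ + 1) * dx := by rw [e1] at hx; linarith
  have h3 : 0 < t - τ + 1 := pos_of_mul_pos_left h2 hdx.le
  have h4 : 0 ≤ (t - τ) * δ := mul_nonneg (by omega) hδ0
  have h5 : 0 ≤ (k - 1) * ε := mul_nonneg (by omega) hε0
  linarith

lemma side_aux (N m : ℕ) (hm : Odd m) (hmN : m = N ∨ m + 1 = N) (A B V : ℤ) (h : ℕ → ℤ)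
    (H1 : ∀ i, Even i → rr (i + 1) * h i - h (i + 1) * rr i = 1)
    (He : ∀ j ≤ N, Even j → B * h j - A * rr j = beta (N - j))
    (Ho : ∀ j ≤ N, Odd j → A * rr j - B * h j = beta (N - j)) :
    (∀ i ≤ m, 0 ≤ A * (cum rr m - cum rr i) - B * (cum h m - cum h i)) ∧
    (∀ i < m, ∀ x y : ℤ, 0 ≤ x → A * x + B * y ≤ A * cum rr m + B * V →
      stp h i * (x - cum rr i) + stp rr i * (y - (V + cum h m - cum h i)) ≤ 0) := by
  have hTe : ∀ i < m, Even i → A * stp rr i - B * stp h i = beta (N - i - 1) := by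
    intro i hi he
    rw [stp_even _ he, stp_even _ he, Ho (i + 1) (by omega) he.add_one, Nat.sub_sub]
  have hTo : ∀ i < m, Odd i → A * stp rr i - B * stp h i
      = beta (N - i - 2) + beta (N - i - 1) := by
    intro i hi ho
    have h2 : i + 2 ≤ N := by
      obtain ⟨a, rfl⟩ := hm
      obtain ⟨b, rfl⟩ := ho
      omega
    have e1 := Ho (i + 2) h2 (by rw [Nat.odd_add]; simp [ho])
    have e2 := He (i + 1) (by omega) ho.add_one
    rw [stp_odd _ ho, stp_odd _ ho, Nat.sub_sub, Nat.sub_sub, ← e1, ← e2]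
    ring
  have hT0 : ∀ i < m, 0 ≤ A * stp rr i - B * stp h i := by
    intro i hi
    rcases Nat.even_or_odd i with he | ho
    · rw [hTe i hi he]; positivity
    · rw [hTo i hi ho]; positivity
  have hstep : ∀ f : ℕ → ℤ, ∀ i, cum f m - cum f i = (cum f m - cum f (i + 1)) + stp f i := by
    intro f i; rw [cum_succ]; ring
  have hnn : ∀ r i, i + r = m → 0 ≤ A * (cum rr m - cum rr i) - B * (cum h m - cum h i) := by
    intro r
    induction r with
    | zero => intro i hi; rw [Nat.add_zero] at hi; subst hi; simp
    | succ r ih =>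
      intro i hi
      have := ih (i + 1) (by omega)
      have := hT0 i (by omega)
      rw [hstep rr i, hstep h i]
      linarith
  have hub : ∀ r i, i + r + 1 = m → A * (cum rr m - cum rr i) - B * (cum h m - cum h i)
      < beta (N - i) := by
    intro r
    induction r with
    | zero =>
      intro i hi
      have he : Even i := by
        obtain ⟨a, rfl⟩ := hm
        exact ⟨a, by omega⟩
      rw [hstep rr i, hstep h i]
      have := hTe i (by omega) he
      have hc : (beta (N - i - 1) : ℤ) < beta (N - i) := by
        rcases hmN with h1 | h1
        · rw [show N - i = 1 by omega]; simp [beta]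
        · rw [show N - i = 2 by omega]; simp [beta]
      rw [show i + 1 = m by omega]
      linarith
    | succ r ih =>
      intro i hi
      have hb := ih (i + 1) (by omega)
      obtain ⟨k, hk⟩ : ∃ k, N - i = k + 2 := ⟨N - i - 2, by omega⟩
      have hr := beta_rec k
      rw [show N - (i + 1) = k + 1 by omega] at hb
      rw [hstep rr i, hstep h i, hk, hr]
      have hk0 : (0 : ℤ) ≤ beta k := by positivity
      rcases Nat.even_or_odd i with he | ho
      · have := hTe i (by omega) he
        rw [show N - i - 1 = k + 1 by omega] at this
        linarith
      · have := hTo i (by omega) ho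
        rw [show N - i - 1 = k + 1 by omega, show N - i - 2 = k by omega] at this
        linarith
  refine ⟨fun i hi => hnn (m - i) i (by omega), ?_⟩
  intro i hi x y hx hxy
  have hb := hub (m - i - 1) i (by omega)
  have hcb := cum_rr_bound i
  rcases Nat.even_or_odd i with he | ho
  · refine edge_aux x y _ _ (stp rr i) (stp h i) (rr i) (h i) A B _ _ _ _ 0 ?_ hx hxy rfl rfl
      rfl (hT0 i hi) ?_ (stp_rr_pos i) ?_ ?_ ?_
    · rw [stp_even _ he, stp_even _ he]; exact H1 i he
    · rw [He i (by omega) he]; positivity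
    · simp [rr]
    · rw [stp_even _ he]
      simp only [he, if_true, rr] at *
      linarith
    · rw [He i (by omega) he]; linarith
  · have ho' := Nat.not_even_iff_odd.mpr ho
    have he1 : Even (i + 1) := ho.add_one
    have h2 : i + 2 ≤ N := by
      obtain ⟨a, rfl⟩ := hm
      obtain ⟨b, rfl⟩ := ho
      omega
    refine edge_aux x y _ _ (stp rr i) (stp h i) (rr (i + 1)) (h (i + 1)) A B _ _ _ _ 1 ?_ hx hxy
      rfl rfl rfl (hT0 i hi) ?_ (stp_rr_pos i) ?_ ?_ ?_
    · rw [stp_odd _ ho, stp_odd _ ho]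
      have := H1 (i + 1) he1
      rw [show i + 1 + 1 = i + 2 by ring] at this
      linarith
    · rw [He (i + 1) (by omega) he1]; positivity
    · simp [rr]
    · simp only [ho', if_false, rr] at *
      linarith
    · rw [He (i + 1) (by omega) he1, hTo i hi ho]
      obtain ⟨k, hk⟩ : ∃ k, N - i = k + 2 := ⟨N - i - 2, by omega⟩
      have hr := beta_rec k
      rw [hk, hr] at hb
      rw [show N - i - 1 = k + 1 by omega, show N - i - 2 = k by omega,
        show N - (i + 1) = k + 1 by omega]
      linarith

lemma det_aux (h : ℕ → ℤ) (hP : ∀ i, h (i + 2) = 2 * h (i + 1) + h i)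
    (H1 : ∀ i, Even i → rr (i + 1) * h i - h (i + 1) * rr i = 1) (i : ℕ) :
    stp h i * stp rr (i + 1) - stp rr i * stp h (i + 1) = -1 := by
  have r1 : ∀ i, rr (i + 2) = 2 * rr (i + 1) + rr i := fun i => beta_rec i
  rcases Nat.even_or_odd i with he | ho
  · have h1 := H1 i he
    rw [stp_even _ he, stp_even _ he, stp_odd _ he.add_one, stp_odd _ he.add_one,
      show i + 1 + 2 = i + 1 + 2 by ring, hP (i + 1), r1 (i + 1),
      show i + 1 + 1 = i + 2 by ring, hP i, r1 i]
    linear_combination -h1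
  · have h1 := H1 (i + 1) ho.add_one
    rw [stp_odd _ ho, stp_odd _ ho, stp_even _ ho.add_one, stp_even _ ho.add_one]
    rw [show i + 1 + 1 = i + 2 by ring] at *
    linear_combination -h1

lemma cassini_even (i : ℕ) (he : Even i) :
    (beta (i + 1) : ℤ) * beta (i + 1) - beta (i + 2) * beta i = 1 := by
  have := beta_D i 1
  rw [he.neg_one_pow] at this
  simpa [beta] using this

lemma H1L (i : ℕ) (he : Even i) : rr (i + 1) * hL i - hL (i + 1) * rr i = 1 := by
  have := cassini_even i he
  have h2 := beta_rec i
  rw [hL_succ]; simp only [hL, rr]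
  rw [h2] at this
  linarith

lemma H1R (i : ℕ) (he : Even i) : rr (i + 1) * hR i - hR (i + 1) * rr i = 1 :=
  cassini_even i he

lemma PL (i : ℕ) : hL (i + 2) = 2 * hL (i + 1) + hL i := by
  rw [hL_succ, hL_succ]; simp only [hL]; ring

lemma PR (i : ℕ) : hR (i + 2) = 2 * hR (i + 1) + hR i := beta_rec (i + 1)

lemma cum_gam (P : ℕ) : cum rr (2 * P + 1) = (gam (2 * P + 2)).1 := by
  induction P with
  | zero => simp [cum, stp, rr, gam, beta]
  | succ P ih =>
    have e1 : Odd (2 * P + 1) := ⟨P, rfl⟩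
    have e2 : Even (2 * P + 1 + 1) := e1.add_one
    rw [show 2 * (P + 1) + 1 = 2 * P + 1 + 1 + 1 by ring, cum_succ, cum_succ, ih, stp_odd _ e1,
      stp_even _ e2, show 2 * (P + 1) + 2 = (2 * P + 1) + 3 by ring, gam,
      show 2 * P + 1 + 2 = 2 * P + 3 by ring, gam]
    simp only [rr]
    have := beta_mono_succ (2 * P + 2)
    push_cast [Nat.cast_sub this]
    ring

lemma cum_nonneg_mono (f : ℕ → ℤ) (hf : ∀ i, 0 ≤ stp f i) : Monotone (cum f) := by
  apply monotone_nat_of_le_succ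
  intro n; rw [cum_succ]; have := hf n; linarith

lemma cum_rr_pos (i : ℕ) : 0 < cum rr (i + 1) := by
  have h := cum_nonneg_mono rr (fun i => (stp_rr_pos i).le) (Nat.zero_le i)
  rw [cum_zero] at h
  rw [cum_succ]; have := stp_rr_pos i; linarith

lemma assemble (P Q : ℕ) (hPQ : P = Q ∨ P = Q + 1) (a b c : ℕ) (ha : a = beta (P + Q + 1))
    (hb : b = beta (P + Q + 2))
    (hc : (c : ℤ) = a * cum rr (2 * P + 1) + b * cum rr (2 * Q + 1)) :
    (twoKnapVert a b c).ncard = 2 * (P + Q + 2) := by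
  obtain ⟨p, hp⟩ : ∃ p, p = 2 * P + 1 := ⟨_, rfl⟩
  obtain ⟨q, hq⟩ : ∃ q, q = 2 * Q + 1 := ⟨_, rfl⟩
  rw [← hp, ← hq] at hc
  have hpo : Odd p := ⟨P, hp⟩
  have hqo : Odd q := ⟨Q, hq⟩
  obtain ⟨L1, L2⟩ := side_aux (P + Q + 2) p hpo (by omega) a b (cum rr q) hL H1L
    (by
      intro j hj he
      have := beta_D_even j (P + Q + 2) he hj
      rw [show P + Q + 2 + 1 = P + Q + 1 + 2 by ring, beta_rec (P + Q + 1),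
        show P + Q + 1 + 1 = P + Q + 2 by ring] at this
      rw [ha, hb, ← this]; simp only [hL, rr]; ring)
    (by
      intro j hj ho
      have := beta_D_odd j (P + Q + 2) ho hj
      rw [show P + Q + 2 + 1 = P + Q + 1 + 2 by ring, beta_rec (P + Q + 1),
        show P + Q + 1 + 1 = P + Q + 2 by ring] at this
      rw [ha, hb, ← this]; simp only [hL, rr]; ring)
  obtain ⟨R1, R2⟩ := side_aux (P + Q + 1) q hqo (by omega) b a (cum rr p) hR H1R
    (by
      intro j hj he
      have := beta_D_even j (P + Q + 1) he hj
      rw [ha, hb, ← this]; simp only [hR, rr])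
    (by
      intro j hj ho
      have := beta_D_odd j (P + Q + 1) ho hj
      rw [ha, hb, ← this]; simp only [hR, rr])
  rw [show 2 * (P + Q + 2) = (p + q) + 2 by omega]
  let X : ℕ → ℤ := fun i => if i ≤ p then cum rr i else cum rr p + cum hR q - cum hR (p + q - i)
  let Y : ℕ → ℤ := fun i => if i ≤ p then cum rr q + cum hL p - cum hL i else cum rr (p + q - i)
  have XL : ∀ i ≤ p, X i = cum rr i := fun i hi => by simp [X, hi]
  have YL : ∀ i ≤ p, Y i = cum rr q + cum hL p - cum hL i := fun i hi => by simp [Y, hi]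
  have XR : ∀ i j, j ≤ q → i + j = p + q → X i = cum rr p + cum hR q - cum hR j := by
    intro i j hj hij
    by_cases h : i ≤ p
    · have h1 : i = p := by omega
      have h2 : j = q := by omega
      subst h1 h2
      simp [X]
    · simp only [X, h, if_false]
      rw [show p + q - i = j by omega]
  have YR : ∀ i j, j ≤ q → i + j = p + q → Y i = cum rr j := by
    intro i j hj hij
    by_cases h : i ≤ p
    · have h1 : i = p := by omega
      have h2 : j = q := by omega
      subst h1 h2
      simp [Y]
    · simp only [Y, h, if_false]
      rw [show p + q - i = j by omega]
  clear_value X Y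
  have split : ∀ i < p + q, i + 1 ≤ p ∨ ∃ j, j + 1 ≤ q ∧ i + (j + 1) = p + q := by
    intro i hi
    by_cases h : i + 1 ≤ p
    · exact Or.inl h
    · exact Or.inr ⟨p + q - i - 1, by omega, by omega⟩
  apply poly_card a b c (p + q) (by omega) X Y
  · rw [XL 0 (by omega), cum_zero]
  · intro i hi
    rcases split i hi with h | ⟨j, hj, hij⟩
    · rw [XL i (by omega), XL (i + 1) h, cum_succ]
      have := stp_rr_pos i; linarith
    · rw [XR i (j + 1) hj hij, XR (i + 1) j (by omega) (by omega), cum_succ]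
      have := stp_hR_pos j; linarith
  · intro i hi
    rcases split i hi with h | ⟨j, hj, hij⟩
    · rw [YL i (by omega)]
      have := cum_nonneg_mono hL stp_hL_nonneg (show i ≤ p by omega)
      have := cum_rr_pos (2 * Q)
      rw [← hq] at this
      linarith
    · rw [YR i (j + 1) hj hij]
      exact cum_rr_pos j
  · rw [YR _ 0 (by omega) (by omega), cum_zero]
  · intro i hi
    by_cases h : i ≤ p
    · have := L1 i h
      rw [XL i h, YL i h, hc]; linarith
    · have := R1 (p + q - i) (by omega)
      rw [XR i (p + q - i) (by omega) (by omega), YR i (p + q - i) (by omega) (by omega), hc]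
      linarith
  · intro i hi x y hx hy hxy
    rcases split i hi with h | ⟨j, hj, hij⟩
    · have := L2 i (by omega) x y hx (by linarith)
      rw [XL i (by omega), XL (i + 1) h, YL i (by omega), YL (i + 1) h, cum_succ, cum_succ]
      linarith
    · have := R2 j (by omega) y x hy (by linarith)
      rw [XR i (j + 1) hj hij, XR (i + 1) j (by omega) (by omega), YR i (j + 1) hj hij,
        YR (i + 1) j (by omega) (by omega), cum_succ, cum_succ]
      linarith
  · intro i hi
    by_cases h : i + 2 ≤ p
    · have := det_aux hL PL H1L i
      rw [XL i (by omega), XL (i + 1) (by omega), XL (i + 2) h, YL i (by omega),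
        YL (i + 1) (by omega), YL (i + 2) h, show i + 2 = i + 1 + 1 by ring]
      simp only [cum_succ]
      intro h0
      linarith
    by_cases h' : i + 1 = p
    · obtain ⟨j, rfl⟩ : ∃ j, q = j + 1 := ⟨q - 1, by omega⟩
      have ie : Even i := ⟨P, by omega⟩
      have je : Even j := ⟨Q, by omega⟩
      have d1 : Y i - Y (i + 1) = beta i := by
        rw [YL i (by omega), YL (i + 1) (by omega), cum_succ hL, stp_even _ ie, hL_succ]; ring
      have d2 : X (i + 1) - X i = beta (i + 1) := by
        rw [XL i (by omega), XL (i + 1) (by omega), cum_succ, stp_even _ ie]; simp [rr]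
      have d3 : X (i + 2) - X (i + 1) = beta (j + 2) := by
        rw [XR (i + 1) (j + 1) (by omega) (by omega), XR (i + 2) j (by omega) (by omega),
          cum_succ, stp_even _ je]; simp only [hR]; ring
      have d4 : Y (i + 1) - Y (i + 2) = beta (j + 1) := by
        rw [YR (i + 1) (j + 1) (by omega) (by omega), YR (i + 2) j (by omega) (by omega),
          cum_succ, stp_even _ je]; simp [rr]
      rw [d1, d2, d3, d4]
      rcases hPQ with h1 | h1
      · have hij : i = j := by omega
        subst hij
        have := cassini_even i ie
        intro h0; linarith
      · have hij : i = j + 2 := by omega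
        subst hij
        have := cassini_even j je
        rw [show j + 2 + 1 = j + 1 + 2 by ring, beta_rec (j + 1), show j + 1 + 1 = j + 2 by ring]
        have h2 := beta_rec j
        intro h0
        have h3 : (beta j : ℤ) = beta (j + 2) - 2 * beta (j + 1) := by linarith
        rw [h3] at this
        linarith
    · obtain ⟨j, hj⟩ : ∃ j, i + (j + 1 + 1) = p + q := ⟨p + q - i - 2, by omega⟩
      have := det_aux hR PR H1R j
      rw [XR i (j + 1 + 1) (by omega) hj, XR (i + 1) (j + 1) (by omega) (by omega),
        XR (i + 2) j (by omega) (by omega), YR i (j + 1 + 1) (by omega) hj,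
        YR (i + 1) (j + 1) (by omega) (by omega), YR (i + 2) j (by omega) (by omega)]
      simp only [cum_succ]
      intro h0
      linarith

/-- Veselov–Shevchenko: for every `s ≥ 3`, taking `a = β_{s−1}`, `b = β_s` and
`c = γ_s(β_{s−1} + β_s)` for even `s`, `c = γ_{s+1}β_{s−1} + γ_{s−1}β_s` for odd `s`,
one has `|𝒩(a,b,c)| = 2s`. -/
theorem card_twoKnapVert_eq (s : ℕ) (hs : 3 ≤ s) (a b c : ℕ)
    (ha : a = beta (s - 1)) (hb : b = beta s)
    (hc : c = if Even s then (gam s).1 * (beta (s - 1) + beta s)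
              else (gam (s + 1)).1 * beta (s - 1) + (gam (s - 1)).1 * beta s) :
    (twoKnapVert a b c).ncard = 2 * s := by
  rcases Nat.even_or_odd s with he | ho
  · obtain ⟨k, hk⟩ := he
    obtain ⟨P, rfl⟩ : ∃ P, s = P + P + 2 := ⟨k - 1, by omega⟩
    rw [if_pos ⟨k, hk⟩, ← hb, ← ha] at hc
    refine assemble P P (Or.inl rfl) a b c ha hb ?_
    rw [cum_gam, hc, show 2 * P + 2 = P + P + 2 by ring]
    push_cast; ring
  · have ho' := Nat.not_even_iff_odd.mpr ho
    obtain ⟨k, hk⟩ := ho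
    obtain ⟨Q, rfl⟩ : ∃ Q, s = Q + 1 + Q + 2 := ⟨k - 1, by omega⟩
    rw [if_neg ho', ← hb, ← ha] at hc
    refine assemble (Q + 1) Q (Or.inr rfl) a b c ha hb ?_
    rw [cum_gam, cum_gam, hc, show Q + 1 + Q + 2 + 1 = 2 * (Q + 1) + 2 by ring,
      show Q + 1 + Q + 2 - 1 = 2 * Q + 2 by omega]
    push_cast; ring
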